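/- For every positive integer N, g(5, 2^N) < 4 · g(4,N)^2. -/

import Mathlib

/-- The Erdős–Rogers function `g(k,N) = f^{(k)}_{k+1,k+2}(N)`: the minimum, over all
`k`-uniform hypergraphs `E` on vertex set `{0,…,N-1}` containing no `k+2` vertices all of whose
`k`-subsets are edges, of the maximum size of a vertex subset containing no `k+1` vertices all
of whose `k`-subsets are edges. -/
noncomputable def erdosRogersG (k N : ℕ) : ℕ :=
  sInf {m : ℕ | ∃ E : Finset ℕ → Prop,
    (¬ ∃ S ⊆ Finset.range N, S.card = k + 2 ∧ ∀ e ⊆ S, e.card = k → E e) ∧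
    m = sSup {c : ℕ | ∃ W ⊆ Finset.range N, W.card = c ∧
      ¬ ∃ S ⊆ W, S.card = k + 1 ∧ ∀ e ⊆ S, e.card = k → E e}}

/-- The index of the highest binary digit in which `u` and `v` differ. -/
noncomputable def topDiff (u v : ℕ) : ℕ := sInf {i | u / 2 ^ (i + 1) = v / 2 ^ (i + 1)}

theorem topDiff_le_iff {u v i : ℕ} : topDiff u v ≤ i ↔ u / 2 ^ (i + 1) = v / 2 ^ (i + 1) := by
  have hne : {i | u / 2 ^ (i + 1) = v / 2 ^ (i + 1)}.Nonempty := by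
    refine ⟨u + v, ?_⟩
    have h : u + v < 2 ^ (u + v + 1) := (Nat.lt_succ_self _).trans Nat.lt_two_pow_self
    change u / _ = v / _
    rw [Nat.div_eq_of_lt (by omega), Nat.div_eq_of_lt (by omega)]
  constructor
  · intro h
    have hm : u / 2 ^ (topDiff u v + 1) = v / 2 ^ (topDiff u v + 1) := Nat.sInf_mem hne
    obtain ⟨k, rfl⟩ := Nat.exists_eq_add_of_le h
    rw [show topDiff u v + k + 1 = (topDiff u v + 1) + k by omega, pow_add,
      ← Nat.div_div_eq_div_mul, ← Nat.div_div_eq_div_mul, hm]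
  · exact fun h => Nat.sInf_le h

theorem topDiff_lt {u v N : ℕ} (huv : u < v) (hv : v < 2 ^ N) : topDiff u v < N := by
  rcases N with _ | n
  · simp at hv; omega
  · rw [Nat.lt_succ_iff, topDiff_le_iff, Nat.div_eq_of_lt (by omega), Nat.div_eq_of_lt hv]

theorem topDiff_eq_max {u v w : ℕ} (huv : u < v) (hvw : v < w) :
    topDiff u w = max (topDiff u v) (topDiff v w) := by
  apply eq_of_forall_ge_iff
  intro i
  rw [max_le_iff, topDiff_le_iff, topDiff_le_iff, topDiff_le_iff]
  have h1 := Nat.div_le_div_right (c := 2 ^ (i + 1)) huv.le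
  have h2 := Nat.div_le_div_right (c := 2 ^ (i + 1)) hvw.le
  omega

theorem div_two_pow_topDiff_lt {u v : ℕ} (huv : u < v) :
    u / 2 ^ topDiff u v < v / 2 ^ topDiff u v := by
  refine lt_of_le_of_ne (Nat.div_le_div_right huv.le) fun h => ?_
  rcases hd : topDiff u v with _ | j
  · rw [hd] at h; simp at h; omega
  · rw [hd] at h
    have := topDiff_le_iff.2 h
    omega

theorem topDiff_ne {u v w : ℕ} (huv : u < v) (hvw : v < w) : topDiff u v ≠ topDiff v w := by
  intro h
  have h1 := div_two_pow_topDiff_lt huv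
  have h2 := div_two_pow_topDiff_lt hvw
  have h3 := topDiff_le_iff.1 (le_refl (topDiff u v))
  have h4 := topDiff_le_iff.1 (le_refl (topDiff v w))
  rw [← h] at h2 h4
  rw [pow_succ, ← Nat.div_div_eq_div_mul, ← Nat.div_div_eq_div_mul] at h3 h4
  omega

theorem topDiff_of_lt_left {u v w : ℕ} (hv : u < v) (hw : u < w)
    (h : topDiff u v < topDiff u w) : v < w ∧ topDiff v w = topDiff u w := by
  rcases lt_trichotomy v w with hvw | rfl | hvw
  · have := topDiff_eq_max hv hvw
    omega
  · omega
  · have := topDiff_eq_max hw hvw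
    omega

theorem topDiff_of_lt_right {u v w : ℕ} (hv : v < u) (hw : w < u)
    (h : topDiff v u < topDiff w u) : w < v ∧ topDiff w v = topDiff w u := by
  rcases lt_trichotomy w v with hvw | rfl | hvw
  · have := topDiff_eq_max hvw hv
    omega
  · omega
  · have := topDiff_eq_max hvw hw
    omega

/-- The patterns of four consecutive values of `topDiff` that are declared edges when stepping up
the `4`-graph `E`. -/
def StepUpPattern (E : Finset ℕ → Prop) (x y z w : ℕ) : Prop :=
  (x < y ∧ y < z ∧ z < w ∧ E {x, y, z, w}) ∨ (y < x ∧ z < y ∧ w < z ∧ E {w, z, y, x}) ∨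
  (x < y ∧ z < y ∧ z < w ∧ w < y) ∨ (y < x ∧ y < z ∧ w < z ∧ x < z)

/-- `StepUpPattern` for the consecutive `topDiff`s of five vertices. -/
def StepUpTuple (E : Finset ℕ → Prop) (a b c d f : ℕ) : Prop :=
  StepUpPattern E (topDiff a b) (topDiff b c) (topDiff c d) (topDiff d f)

/-- The `5`-graph obtained by stepping up the `4`-graph `E`. -/
def StepUp (E : Finset ℕ → Prop) (e : Finset ℕ) : Prop :=
  ∃ a b c d f, a < b ∧ b < c ∧ c < d ∧ d < f ∧ e = {a, b, c, d, f} ∧ StepUpTuple E a b c d f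

theorem sort_quintuple {a b c d f : ℕ} (h1 : a < b) (h2 : b < c) (h3 : c < d) (h4 : d < f) :
    ({a, b, c, d, f} : Finset ℕ).sort (· ≤ ·) = [a, b, c, d, f] := by
  have h : ({a, b, c, d, f} : Finset ℕ) = [a, b, c, d, f].toFinset := by simp
  rw [h]
  refine (List.toFinset_sort (· ≤ ·) ?_).2 ?_
  · simp; omega
  · simp; omega

theorem stepUpTuple_of_stepUp {E : Finset ℕ → Prop} {a b c d f : ℕ} (h1 : a < b) (h2 : b < c)
    (h3 : c < d) (h4 : d < f) (h : StepUp E {a, b, c, d, f}) : StepUpTuple E a b c d f := by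
  obtain ⟨a', b', c', d', f', g1, g2, g3, g4, he, h⟩ := h
  have := sort_quintuple h1 h2 h3 h4
  rw [he, sort_quintuple g1 g2 g3 g4] at this
  simp only [List.cons.injEq, and_true] at this
  obtain ⟨rfl, rfl, rfl, rfl, rfl⟩ := this
  exact h

/-- Six vertices all of whose ordered `5`-subtuples are edges form a clique. -/
theorem stepUp_clique {E : Finset ℕ → Prop} {W : Finset ℕ} {a b c d f g : ℕ}
    (ha : a ∈ W) (hb : b ∈ W) (hc : c ∈ W) (hd : d ∈ W) (hf : f ∈ W) (hg : g ∈ W)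
    (h1 : a < b) (h2 : b < c) (h3 : c < d) (h4 : d < f) (h5 : f < g)
    (ka : StepUpTuple E b c d f g) (kb : StepUpTuple E a c d f g) (kc : StepUpTuple E a b d f g)
    (kd : StepUpTuple E a b c f g) (kf : StepUpTuple E a b c d g)
    (kg : StepUpTuple E a b c d f) :
    ∃ S ⊆ W, S.card = 6 ∧ ∀ e ⊆ S, e.card = 5 → StepUp E e := by
  have hS : ({a, b, c, d, f, g} : Finset ℕ).card = 6 := by
    repeat rw [Finset.card_insert_of_notMem (by simp; omega)]
    simp
  refine ⟨{a, b, c, d, f, g}, ?_, hS, ?_⟩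
  · simp [Finset.insert_subset_iff, *]
  · intro e he hcard
    have hx : (({a, b, c, d, f, g} : Finset ℕ) \ e).card = 1 := by
      rw [Finset.card_sdiff_of_subset he, hS, hcard]
    obtain ⟨x, hx⟩ := Finset.card_eq_one.1 hx
    have he' : e = ({a, b, c, d, f, g} : Finset ℕ) \ {x} := by
      rw [← hx, Finset.sdiff_sdiff_eq_self he]
    have hxm : x ∈ ({a, b, c, d, f, g} : Finset ℕ) :=
      Finset.sdiff_subset (hx ▸ Finset.mem_singleton_self x)
    simp only [Finset.mem_insert, Finset.mem_singleton] at hxm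
    rcases hxm with rfl | rfl | rfl | rfl | rfl | rfl
    · refine ⟨_, _, _, _, _, h2, h3, h4, h5, ?_, ka⟩
      rw [he']; ext y; simp; omega
    · refine ⟨_, _, _, _, _, h1.trans h2, h3, h4, h5, ?_, kb⟩
      rw [he']; ext y; simp; omega
    · refine ⟨_, _, _, _, _, h1, h2.trans h3, h4, h5, ?_, kc⟩
      rw [he']; ext y; simp; omega
    · refine ⟨_, _, _, _, _, h1, h2, h3.trans h4, h5, ?_, kd⟩
      rw [he']; ext y; simp; omega
    · refine ⟨_, _, _, _, _, h1, h2, h3, h4.trans h5, ?_, kf⟩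
      rw [he']; ext y; simp; omega
    · refine ⟨_, _, _, _, _, h1, h2, h3, h4, ?_, kg⟩
      rw [he']; ext y; simp; omega

theorem card_quadruple {a b c d : ℕ} (h1 : a < b) (h2 : b < c) (h3 : c < d) :
    ({a, b, c, d} : Finset ℕ).card = 4 := by
  repeat rw [Finset.card_insert_of_notMem (by simp; omega)]
  simp

theorem exists_sorted_quadruple {e : Finset ℕ} (he : e.card = 4) :
    ∃ a b c d, a < b ∧ b < c ∧ c < d ∧ e = {a, b, c, d} := by
  let f := e.orderEmbOfFin he
  have h1 : f 0 < f 1 := f.strictMono (by decide)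
  have h2 : f 1 < f 2 := f.strictMono (by decide)
  have h3 : f 2 < f 3 := f.strictMono (by decide)
  refine ⟨_, _, _, _, h1, h2, h3, ?_⟩
  symm
  apply Finset.eq_of_subset_of_card_le
  · simp [Finset.insert_subset_iff, f, Finset.orderEmbOfFin_mem]
  · rw [he, card_quadruple h1 h2 h3]

/-- The values `topDiff v w` over the `w ∈ W` above `v`. -/
noncomputable def upDiffs (W : Finset ℕ) (v : ℕ) : Finset ℕ :=
  {w ∈ W | v < w}.image (topDiff v)

/-- The values `topDiff w v` over the `w ∈ W` below `v`. -/
noncomputable def downDiffs (W : Finset ℕ) (v : ℕ) : Finset ℕ :=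
  {w ∈ W | w < v}.image (topDiff · v)

theorem mem_upDiffs {W : Finset ℕ} {v t : ℕ} :
    t ∈ upDiffs W v ↔ ∃ w ∈ W, v < w ∧ topDiff v w = t := by
  simp [upDiffs, and_assoc]

theorem mem_downDiffs {W : Finset ℕ} {v t : ℕ} :
    t ∈ downDiffs W v ↔ ∃ w ∈ W, w < v ∧ topDiff w v = t := by
  simp [downDiffs, and_assoc]

theorem upDiffs_mono {W V : Finset ℕ} (h : V ⊆ W) (v : ℕ) : upDiffs V v ⊆ upDiffs W v := by
  intro t ht
  rw [mem_upDiffs] at ht ⊢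
  exact ht.imp fun w hw => ⟨h hw.1, hw.2⟩

theorem downDiffs_mono {W V : Finset ℕ} (h : V ⊆ W) (v : ℕ) :
    downDiffs V v ⊆ downDiffs W v := by
  intro t ht
  rw [mem_downDiffs] at ht ⊢
  exact ht.imp fun w hw => ⟨h hw.1, hw.2⟩

theorem stepUp_clique_of_upDiffs {E : Finset ℕ → Prop} {W T : Finset ℕ} {v : ℕ} (hv : v ∈ W)
    (hT : T ⊆ upDiffs W v) (hc : T.card = 5) (hE : ∀ e ⊆ T, e.card = 4 → E e) :
    ∃ S ⊆ W, S.card = 6 ∧ ∀ e ⊆ S, e.card = 5 → StepUp E e := by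
  let f := T.orderEmbOfFin hc
  have hE' : ∀ i j k l : Fin 5, i < j → j < k → k < l → E {f i, f j, f k, f l} := by
    intro i j k l hij hjk hkl
    apply hE
    · simp [Finset.insert_subset_iff, f, Finset.orderEmbOfFin_mem]
    · exact card_quadruple (f.strictMono hij) (f.strictMono hjk) (f.strictMono hkl)
  have hw : ∀ i, ∃ w ∈ W, v < w ∧ topDiff v w = f i :=
    fun i => mem_upDiffs.1 (hT (Finset.orderEmbOfFin_mem T hc i))
  choose w hwW hvw hwf using hw
  have hlt : ∀ i j, i < j → w i < w j ∧ topDiff (w i) (w j) = f j := by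
    intro i j hij
    have := topDiff_of_lt_left (hvw i) (hvw j) (by rw [hwf, hwf]; exact f.strictMono hij)
    rwa [hwf] at this
  have key1 : ∀ i j k l : Fin 5, i < j → j < k → k < l →
      StepUpTuple E v (w i) (w j) (w k) (w l) := by
    intro i j k l hij hjk hkl
    left
    rw [hwf, (hlt i j hij).2, (hlt j k hjk).2, (hlt k l hkl).2]
    exact ⟨f.strictMono hij, f.strictMono hjk, f.strictMono hkl, hE' i j k l hij hjk hkl⟩
  refine stepUp_clique hv (hwW 0) (hwW 1) (hwW 2) (hwW 3) (hwW 4) (hvw 0)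
    (hlt 0 1 (by decide)).1 (hlt 1 2 (by decide)).1 (hlt 2 3 (by decide)).1
    (hlt 3 4 (by decide)).1 ?_ (key1 1 2 3 4 (by decide) (by decide) (by decide))
    (key1 0 2 3 4 (by decide) (by decide) (by decide))
    (key1 0 1 3 4 (by decide) (by decide) (by decide))
    (key1 0 1 2 4 (by decide) (by decide) (by decide))
    (key1 0 1 2 3 (by decide) (by decide) (by decide))
  left
  rw [(hlt 0 1 (by decide)).2, (hlt 1 2 (by decide)).2, (hlt 2 3 (by decide)).2,
    (hlt 3 4 (by decide)).2]
  exact ⟨f.strictMono (by decide), f.strictMono (by decide), f.strictMono (by decide),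
    hE' 1 2 3 4 (by decide) (by decide) (by decide)⟩

theorem stepUp_clique_of_downDiffs {E : Finset ℕ → Prop} {W T : Finset ℕ} {v : ℕ} (hv : v ∈ W)
    (hT : T ⊆ downDiffs W v) (hc : T.card = 5) (hE : ∀ e ⊆ T, e.card = 4 → E e) :
    ∃ S ⊆ W, S.card = 6 ∧ ∀ e ⊆ S, e.card = 5 → StepUp E e := by
  let f := T.orderEmbOfFin hc
  have hE' : ∀ i j k l : Fin 5, i < j → j < k → k < l → E {f i, f j, f k, f l} := by
    intro i j k l hij hjk hkl
    apply hE
    · simp [Finset.insert_subset_iff, f, Finset.orderEmbOfFin_mem]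
    · exact card_quadruple (f.strictMono hij) (f.strictMono hjk) (f.strictMono hkl)
  have hw : ∀ i, ∃ w ∈ W, w < v ∧ topDiff w v = f i :=
    fun i => mem_downDiffs.1 (hT (Finset.orderEmbOfFin_mem T hc i))
  choose w hwW hvw hwf using hw
  have hlt : ∀ i j, i < j → w j < w i ∧ topDiff (w j) (w i) = f j := by
    intro i j hij
    have := topDiff_of_lt_right (hvw i) (hvw j) (by rw [hwf, hwf]; exact f.strictMono hij)
    rwa [hwf] at this
  have key1 : ∀ i j k l : Fin 5, i < j → j < k → k < l →
      StepUpTuple E (w l) (w k) (w j) (w i) v := by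
    intro i j k l hij hjk hkl
    right; left
    rw [hwf, (hlt i j hij).2, (hlt j k hjk).2, (hlt k l hkl).2]
    exact ⟨f.strictMono hkl, f.strictMono hjk, f.strictMono hij, hE' i j k l hij hjk hkl⟩
  refine stepUp_clique (hwW 4) (hwW 3) (hwW 2) (hwW 1) (hwW 0) hv
    (hlt 3 4 (by decide)).1 (hlt 2 3 (by decide)).1 (hlt 1 2 (by decide)).1
    (hlt 0 1 (by decide)).1 (hvw 0)
    (key1 0 1 2 3 (by decide) (by decide) (by decide))
    (key1 0 1 2 4 (by decide) (by decide) (by decide))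
    (key1 0 1 3 4 (by decide) (by decide) (by decide))
    (key1 0 2 3 4 (by decide) (by decide) (by decide))
    (key1 1 2 3 4 (by decide) (by decide) (by decide)) ?_
  right; left
  rw [(hlt 0 1 (by decide)).2, (hlt 1 2 (by decide)).2, (hlt 2 3 (by decide)).2,
    (hlt 3 4 (by decide)).2]
  exact ⟨f.strictMono (by decide), f.strictMono (by decide), f.strictMono (by decide),
    hE' 1 2 3 4 (by decide) (by decide) (by decide)⟩

/-- The zigzag configuration with a dominant middle value is a clique. -/
theorem stepUp_clique_of_zigzag {E : Finset ℕ → Prop} {W : Finset ℕ} {a b c d f g : ℕ}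
    (ha : a ∈ W) (hb : b ∈ W) (hc : c ∈ W) (hd : d ∈ W) (hf : f ∈ W) (hg : g ∈ W)
    (h1 : a < b) (h2 : b < c) (h3 : c < d) (h4 : d < f) (h5 : f < g)
    (k1 : topDiff b c < topDiff a b) (k2 : topDiff d f < topDiff f g)
    (k3 : topDiff a b < topDiff c d) (k4 : topDiff f g < topDiff c d) :
    ∃ S ⊆ W, S.card = 6 ∧ ∀ e ⊆ S, e.card = 5 → StepUp E e := by
  have m1 := topDiff_eq_max h1 h2
  have m2 := topDiff_eq_max h2 h3
  have m3 := topDiff_eq_max h3 h4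
  have m4 := topDiff_eq_max h4 h5
  apply stepUp_clique (E := E) ha hb hc hd hf hg h1 h2 h3 h4 h5
  · right; right; left; omega
  · right; right; left; omega
  · right; right; left; omega
  · right; right; right; omega
  · right; right; right; omega
  · right; right; right; omega

theorem exists_card_le {E : Finset ℕ → Prop} {m : ℕ} (n : ℕ) : ∀ W : Finset ℕ, W.card = n →
    W.Nonempty → (¬ ∃ S ⊆ W, S.card = 6 ∧ ∀ e ⊆ S, e.card = 5 → StepUp E e) →
    (∀ v ∈ W, (upDiffs W v).card ≤ m) → (∀ v ∈ W, (downDiffs W v).card ≤ m) →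
    ∃ v ∈ W, W.card ≤ 1 + m * ((upDiffs W v).card + (downDiffs W v).card) := by
  induction n using Nat.strong_induction_on with
  | _ n ih =>
  intro W hn hW hfree hup hdown
  set x := W.min' hW with hx
  set y := W.max' hW with hy
  have hxW : x ∈ W := W.min'_mem hW
  have hyW : y ∈ W := W.max'_mem hW
  have hxle : ∀ v ∈ W, x ≤ v := fun v hv => W.min'_le v hv
  have hyle : ∀ v ∈ W, v ≤ y := fun v hv => W.le_max' v hv
  rcases eq_or_lt_of_le (hxle y hyW) with hxy | hxy
  · refine ⟨x, hxW, ?_⟩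
    have : W.card ≤ 1 := Finset.card_le_one.2 fun a ha b hb => by
      have := hxle a ha; have := hxle b hb; have := hyle a ha; have := hyle b hb; omega
    omega
  set t := topDiff x y with ht
  set R := {v ∈ W | x < v ∧ topDiff x v = t} with hR
  set L := {v ∈ W | ¬ (x < v ∧ topDiff x v = t)} with hL
  have hcard : R.card + L.card = W.card := Finset.card_filter_add_card_filter_not _
  have hRW : R ⊆ W := Finset.filter_subset _ _
  have hLW : L ⊆ W := Finset.filter_subset _ _
  have hxL : x ∈ L := by simp [hL, hxW]
  have hyR : y ∈ R := by simp [hR, hyW, hxy, ht]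
  have hRx : ∀ v ∈ R, x < v ∧ topDiff x v = t := fun v hv => (Finset.mem_filter.1 hv).2
  have hLx : ∀ v ∈ L, x < v → topDiff x v < t := by
    intro v hv hxv
    have h1 := (Finset.mem_filter.1 hv).2
    rcases eq_or_lt_of_le (hyle v (hLW hv)) with rfl | hvy
    · exact absurd ⟨hxv, rfl⟩ h1
    · have := topDiff_eq_max hxv hvy
      have : topDiff x v ≠ t := fun h => h1 ⟨hxv, h⟩
      omega
  have hLR : ∀ u ∈ L, ∀ v ∈ R, u < v ∧ topDiff u v = t := by
    intro u hu v hv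
    obtain ⟨h1, h2⟩ := hRx v hv
    rcases eq_or_lt_of_le (hxle u (hLW hu)) with rfl | hxu
    · exact ⟨h1, h2⟩
    · rw [← h2]
      exact topDiff_of_lt_left hxu h1 (by rw [h2]; exact hLx u hu hxu)
  have hLL : ∀ u ∈ L, ∀ v ∈ L, u < v → topDiff u v < t := by
    intro u hu v hv huv
    rcases eq_or_lt_of_le (hxle u (hLW hu)) with rfl | hxu
    · exact hLx v hv huv
    · have := topDiff_eq_max hxu huv
      have := hLx v hv (hxu.trans huv)
      omega
  have hRR : ∀ u ∈ R, ∀ v ∈ R, u < v → topDiff u v < t := by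
    intro u hu v hv huv
    have h1 := topDiff_eq_max (hRx u hu).1 huv
    have h2 := topDiff_ne (hRx u hu).1 huv
    rw [(hRx u hu).2, (hRx v hv).2] at h1
    rw [(hRx u hu).2] at h2
    omega
  have hfree' : ∀ V ⊆ W, ¬ ∃ S ⊆ V, S.card = 6 ∧ ∀ e ⊆ S, e.card = 5 → StepUp E e :=
    fun V hV ⟨S, hS, h⟩ => hfree ⟨S, hS.trans hV, h⟩
  have hLpos : 0 < L.card := Finset.card_pos.2 ⟨x, hxL⟩
  have hRpos : 0 < R.card := Finset.card_pos.2 ⟨y, hyR⟩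
  by_cases hD : ∃ a ∈ L, ∃ b ∈ L, ∃ c ∈ L, a < b ∧ b < c ∧ topDiff b c < topDiff a b
  · have hU : ¬ ∃ a ∈ R, ∃ b ∈ R, ∃ c ∈ R, a < b ∧ b < c ∧ topDiff a b < topDiff b c := by
      rintro ⟨d, hd, f, hf, g, hg, h4, h5, k2⟩
      obtain ⟨a, ha, b, hb, c, hc, h1, h2, k1⟩ := hD
      obtain ⟨h3, h3t⟩ := hLR c hc d hd
      refine hfree (stepUp_clique_of_zigzag (hLW ha) (hLW hb) (hLW hc) (hRW hd) (hRW hf)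
        (hRW hg) h1 h2 h3 h4 h5 k1 k2 ?_ ?_)
      · rw [h3t]; exact hLL a ha b hb h1
      · rw [h3t]; exact hRR f hf g hg h5
    have hRm : R.card ≤ m := by
      refine le_trans ?_ (hdown y hyW)
      have hinj : Set.InjOn (fun v => if v = y then t else topDiff v y) R := by
        have aux : ∀ u ∈ R, ∀ v ∈ R, u < v →
            (if u = y then t else topDiff u y) ≠ (if v = y then t else topDiff v y) := by
          intro u hu v hv huv
          have hvy := hyle v (hRW hv)
          rw [if_neg (by omega)]
          have h1 := hRR u hu y hyR (by omega)
          split_ifs with hv'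
          · omega
          · intro heq
            have h2 : v < y := by omega
            have h3 := topDiff_eq_max huv h2
            have h4 := topDiff_ne huv h2
            exact hU ⟨u, hu, v, hv, y, hyR, huv, h2, by omega⟩
        intro u hu v hv huv
        rcases lt_trichotomy u v with h | h | h
        · exact absurd huv (aux u hu v hv h)
        · exact h
        · exact absurd huv.symm (aux v hv u hu h)
      refine Finset.card_le_card_of_injOn _ ?_ hinj
      intro v hv
      have hvR : v ∈ R := hv
      simp only [Finset.mem_coe]
      rw [mem_downDiffs]
      split_ifs with h
      · exact ⟨x, hxW, hxy, rfl⟩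
      · exact ⟨v, hRW hvR, lt_of_le_of_ne (hyle v (hRW hvR)) h, rfl⟩
    obtain ⟨v, hv, hle⟩ := ih L.card (by omega) L rfl ⟨x, hxL⟩ (hfree' L hLW)
      (fun v hv => (Finset.card_le_card (upDiffs_mono hLW v)).trans (hup v (hLW hv)))
      (fun v hv => (Finset.card_le_card (downDiffs_mono hLW v)).trans (hdown v (hLW hv)))
    refine ⟨v, hLW hv, ?_⟩
    have h1 := Finset.card_le_card (downDiffs_mono hLW v)
    have h2 : (upDiffs L v).card + 1 ≤ (upDiffs W v).card := by
      apply Finset.card_lt_card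
      refine (Finset.ssubset_iff_of_subset (upDiffs_mono hLW v)).2 ⟨t, ?_, ?_⟩
      · obtain ⟨h3, h4⟩ := hLR v hv y hyR
        exact mem_upDiffs.2 ⟨y, hyW, h3, h4⟩
      · rw [mem_upDiffs]
        rintro ⟨u, hu, huv, h⟩
        exact absurd h (hLL v hv u hu huv).ne
    have h3 : m * ((upDiffs L v).card + (downDiffs L v).card + 1) ≤
        m * ((upDiffs W v).card + (downDiffs W v).card) := Nat.mul_le_mul_left m (by omega)
    rw [Nat.mul_add m _ 1] at h3
    omega
  · have hLm : L.card ≤ m := by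
      refine le_trans ?_ (hup x hxW)
      have hinj : Set.InjOn (fun v => if v = x then t else topDiff x v) L := by
        have aux : ∀ u ∈ L, ∀ v ∈ L, u < v →
            (if u = x then t else topDiff x u) ≠ (if v = x then t else topDiff x v) := by
          intro u hu v hv huv
          have hxu := hxle u (hLW hu)
          rw [if_neg (show v ≠ x by omega)]
          have h1 := hLL x hxL v hv (by omega)
          split_ifs with hu'
          · omega
          · intro heq
            have h2 : x < u := by omega
            have h3 := topDiff_eq_max h2 huv
            have h4 := topDiff_ne h2 huv
            exact hD ⟨x, hxL, u, hu, v, hv, h2, huv, by omega⟩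
        intro u hu v hv huv
        rcases lt_trichotomy u v with h | h | h
        · exact absurd huv (aux u hu v hv h)
        · exact h
        · exact absurd huv.symm (aux v hv u hu h)
      refine Finset.card_le_card_of_injOn _ ?_ hinj
      intro v hv
      have hvL : v ∈ L := hv
      simp only [Finset.mem_coe]
      rw [mem_upDiffs]
      split_ifs with h
      · exact ⟨y, hyW, hxy, rfl⟩
      · exact ⟨v, hLW hvL, lt_of_le_of_ne (hxle v (hLW hvL)) (Ne.symm h), rfl⟩
    obtain ⟨v, hv, hle⟩ := ih R.card (by omega) R rfl ⟨y, hyR⟩ (hfree' R hRW)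
      (fun v hv => (Finset.card_le_card (upDiffs_mono hRW v)).trans (hup v (hRW hv)))
      (fun v hv => (Finset.card_le_card (downDiffs_mono hRW v)).trans (hdown v (hRW hv)))
    refine ⟨v, hRW hv, ?_⟩
    have h1 := Finset.card_le_card (upDiffs_mono hRW v)
    have h2 : (downDiffs R v).card + 1 ≤ (downDiffs W v).card := by
      apply Finset.card_lt_card
      refine (Finset.ssubset_iff_of_subset (downDiffs_mono hRW v)).2 ⟨t, ?_, ?_⟩
      · exact mem_downDiffs.2 ⟨x, hxW, hRx v hv⟩
      · rw [mem_downDiffs]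
        rintro ⟨u, hu, huv, h⟩
        exact absurd h (hRR u hu v hv huv).ne
    have h3 : m * ((upDiffs R v).card + (downDiffs R v).card + 1) ≤
        m * ((upDiffs W v).card + (downDiffs W v).card) := Nat.mul_le_mul_left m (by omega)
    rw [Nat.mul_add m _ 1] at h3
    omega

theorem card_le_of_stepUp_free {E : Finset ℕ → Prop} {m N : ℕ}
    (hE : ∀ T ⊆ Finset.range N, m < T.card →
      ∃ S ⊆ T, S.card = 5 ∧ ∀ e ⊆ S, e.card = 4 → E e)
    {W : Finset ℕ} (hW : W ⊆ Finset.range (2 ^ N))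
    (hfree : ¬ ∃ S ⊆ W, S.card = 6 ∧ ∀ e ⊆ S, e.card = 5 → StepUp E e) :
    W.card ≤ 1 + m * (m + m) := by
  rcases W.eq_empty_or_nonempty with rfl | hne
  · simp
  have hup : ∀ v ∈ W, (upDiffs W v).card ≤ m := by
    intro v hv
    by_contra! h
    obtain ⟨S, hS, hc, hS'⟩ := hE (upDiffs W v) (fun t ht => by
      obtain ⟨w, hw, hvw, rfl⟩ := mem_upDiffs.1 ht
      exact Finset.mem_range.2 (topDiff_lt hvw (Finset.mem_range.1 (hW hw)))) h
    exact hfree (stepUp_clique_of_upDiffs hv hS hc hS')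
  have hdown : ∀ v ∈ W, (downDiffs W v).card ≤ m := by
    intro v hv
    by_contra! h
    obtain ⟨S, hS, hc, hS'⟩ := hE (downDiffs W v) (fun t ht => by
      obtain ⟨w, hw, hvw, rfl⟩ := mem_downDiffs.1 ht
      exact Finset.mem_range.2 (topDiff_lt hvw (Finset.mem_range.1 (hW hv)))) h
    exact hfree (stepUp_clique_of_downDiffs hv hS hc hS')
  obtain ⟨v, hv, h⟩ := exists_card_le _ W rfl hne hfree hup hdown
  have := Nat.mul_le_mul_left m (add_le_add (hup v hv) (hdown v hv))
  omega

theorem stepUp_cliqueFree {E : Finset ℕ → Prop} {N : ℕ}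
    (hE : ¬ ∃ S ⊆ Finset.range N, S.card = 6 ∧ ∀ e ⊆ S, e.card = 4 → E e) :
    ¬ ∃ S ⊆ Finset.range (2 ^ N), S.card = 7 ∧ ∀ e ⊆ S, e.card = 5 → StepUp E e := by
  rintro ⟨S, hS, hc, hclique⟩
  have htuple : ∀ a ∈ S, ∀ b ∈ S, ∀ c ∈ S, ∀ d ∈ S, ∀ f ∈ S, a < b → b < c → c < d → d < f →
      StepUpTuple E a b c d f := by
    intro a ha b hb c hc d hd f hf h1 h2 h3 h4
    refine stepUpTuple_of_stepUp h1 h2 h3 h4 (hclique _ ?_ ?_)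
    · simp [Finset.insert_subset_iff, *]
    · repeat rw [Finset.card_insert_of_notMem (by simp; omega)]
      simp
  let p := S.orderEmbOfFin hc
  have hp : ∀ i, p i ∈ S := fun i => Finset.orderEmbOfFin_mem S hc i
  have hlt : ∀ i j, i < j → p i < p j := fun i j h => p.strictMono h
  have hN : ∀ i j, i < j → topDiff (p i) (p j) < N :=
    fun i j h => topDiff_lt (hlt i j h) (Finset.mem_range.1 (hS (hp j)))
  have h01 := hlt 0 1 (by decide)
  have h12 := hlt 1 2 (by decide)
  have h23 := hlt 2 3 (by decide)
  have h34 := hlt 3 4 (by decide)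
  have h45 := hlt 4 5 (by decide)
  have h56 := hlt 5 6 (by decide)
  have q1 := htuple _ (hp 0) _ (hp 1) _ (hp 2) _ (hp 3) _ (hp 4) h01 h12 h23 h34
  have q2 := htuple _ (hp 1) _ (hp 2) _ (hp 3) _ (hp 4) _ (hp 5) h12 h23 h34 h45
  have q3 := htuple _ (hp 2) _ (hp 3) _ (hp 4) _ (hp 5) _ (hp 6) h23 h34 h45 h56
  have hmono : (topDiff (p 0) (p 1) < topDiff (p 1) (p 2) ∧
      topDiff (p 1) (p 2) < topDiff (p 2) (p 3) ∧ topDiff (p 2) (p 3) < topDiff (p 3) (p 4) ∧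
      topDiff (p 3) (p 4) < topDiff (p 4) (p 5) ∧ topDiff (p 4) (p 5) < topDiff (p 5) (p 6)) ∨
      (topDiff (p 1) (p 2) < topDiff (p 0) (p 1) ∧
      topDiff (p 2) (p 3) < topDiff (p 1) (p 2) ∧ topDiff (p 3) (p 4) < topDiff (p 2) (p 3) ∧
      topDiff (p 4) (p 5) < topDiff (p 3) (p 4) ∧ topDiff (p 5) (p 6) < topDiff (p 4) (p 5)) := by
    unfold StepUpTuple StepUpPattern at q1 q2 q3
    omega
  refine hE ⟨{topDiff (p 0) (p 1), topDiff (p 1) (p 2), topDiff (p 2) (p 3),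
    topDiff (p 3) (p 4), topDiff (p 4) (p 5), topDiff (p 5) (p 6)}, ?_, ?_, ?_⟩
  · simp [Finset.insert_subset_iff, hN]
  · repeat rw [Finset.card_insert_of_notMem (by simp; omega)]
    simp
  intro e he hec
  obtain ⟨a, b, c, d, hab, hbc, hcd, rfl⟩ := exists_sorted_quadruple hec
  rcases hmono with hinc | hdec
  · have hrep : ∀ t ∈ ({a, b, c, d} : Finset ℕ), ∃ w ∈ S, p 0 < w ∧ topDiff (p 0) w = t := by
      intro t ht
      have ht := he ht
      have m2 := topDiff_eq_max h01 h12
      have m3 := topDiff_eq_max (h01.trans h12) h23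
      have m4 := topDiff_eq_max ((h01.trans h12).trans h23) h34
      have m5 := topDiff_eq_max (((h01.trans h12).trans h23).trans h34) h45
      have m6 := topDiff_eq_max ((((h01.trans h12).trans h23).trans h34).trans h45) h56
      simp only [Finset.mem_insert, Finset.mem_singleton] at ht
      rcases ht with h | h | h | h | h | h
      · exact ⟨p 1, hp 1, by omega, by omega⟩
      · exact ⟨p 2, hp 2, by omega, by omega⟩
      · exact ⟨p 3, hp 3, by omega, by omega⟩
      · exact ⟨p 4, hp 4, by omega, by omega⟩
      · exact ⟨p 5, hp 5, by omega, by omega⟩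
      · exact ⟨p 6, hp 6, by omega, by omega⟩
    obtain ⟨wa, hwa, pa, rfl⟩ := hrep a (by simp)
    obtain ⟨wb, hwb, pb, rfl⟩ := hrep b (by simp)
    obtain ⟨wc, hwc, pc, rfl⟩ := hrep c (by simp)
    obtain ⟨wd, hwd, pd, rfl⟩ := hrep d (by simp)
    obtain ⟨r1, s1⟩ := topDiff_of_lt_left pa pb hab
    obtain ⟨r2, s2⟩ := topDiff_of_lt_left pb pc hbc
    obtain ⟨r3, s3⟩ := topDiff_of_lt_left pc pd hcd
    have q := htuple _ (hp 0) _ hwa _ hwb _ hwc _ hwd pa r1 r2 r3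
    unfold StepUpTuple StepUpPattern at q
    rw [s1, s2, s3] at q
    rcases q with q | q | q | q
    · exact q.2.2.2
    all_goals omega
  · have hrep : ∀ t ∈ ({a, b, c, d} : Finset ℕ), ∃ w ∈ S, w < p 6 ∧ topDiff w (p 6) = t := by
      intro t ht
      have ht := he ht
      have m4 := topDiff_eq_max h45 h56
      have m3 := topDiff_eq_max h34 (h45.trans h56)
      have m2 := topDiff_eq_max h23 (h34.trans (h45.trans h56))
      have m1 := topDiff_eq_max h12 (h23.trans (h34.trans (h45.trans h56)))
      have m0 := topDiff_eq_max h01 (h12.trans (h23.trans (h34.trans (h45.trans h56))))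
      simp only [Finset.mem_insert, Finset.mem_singleton] at ht
      rcases ht with h | h | h | h | h | h
      · exact ⟨p 0, hp 0, by omega, by omega⟩
      · exact ⟨p 1, hp 1, by omega, by omega⟩
      · exact ⟨p 2, hp 2, by omega, by omega⟩
      · exact ⟨p 3, hp 3, by omega, by omega⟩
      · exact ⟨p 4, hp 4, by omega, by omega⟩
      · exact ⟨p 5, hp 5, by omega, by omega⟩
    obtain ⟨wa, hwa, pa, rfl⟩ := hrep a (by simp)
    obtain ⟨wb, hwb, pb, rfl⟩ := hrep b (by simp)
    obtain ⟨wc, hwc, pc, rfl⟩ := hrep c (by simp)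
    obtain ⟨wd, hwd, pd, rfl⟩ := hrep d (by simp)
    obtain ⟨r1, s1⟩ := topDiff_of_lt_right pa pb hab
    obtain ⟨r2, s2⟩ := topDiff_of_lt_right pb pc hbc
    obtain ⟨r3, s3⟩ := topDiff_of_lt_right pc pd hcd
    have q := htuple _ hwd _ hwc _ hwb _ hwa _ (hp 6) r3 r2 r1 pa
    unfold StepUpTuple StepUpPattern at q
    rw [s1, s2, s3] at q
    rcases q with q | q | q | q
    · omega
    · exact q.2.2.2
    all_goals omega

/-- For every positive integer `N`, `g(5, 2^N) < 4 · g(4,N)^2`. -/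
theorem stmt4 : ∀ N : ℕ, 1 ≤ N →
    erdosRogersG 5 (2 ^ N) < 4 * (erdosRogersG 4 N) ^ 2 := by
  intro N hN
  have hmem : erdosRogersG 4 N ∈ {m : ℕ | ∃ E : Finset ℕ → Prop,
      (¬ ∃ S ⊆ Finset.range N, S.card = 4 + 2 ∧ ∀ e ⊆ S, e.card = 4 → E e) ∧
      m = sSup {c : ℕ | ∃ W ⊆ Finset.range N, W.card = c ∧
        ¬ ∃ S ⊆ W, S.card = 4 + 1 ∧ ∀ e ⊆ S, e.card = 4 → E e}} := by
    refine Nat.sInf_mem ⟨_, fun _ => False, ?_, rfl⟩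
    rintro ⟨S, -, hc, h⟩
    obtain ⟨e, he, hec⟩ := Finset.exists_subset_card_eq (show 4 ≤ S.card by omega)
    exact h e he hec
  obtain ⟨E, hfree, hm⟩ := hmem
  set m := erdosRogersG 4 N
  have hle : ∀ W ⊆ Finset.range N,
      (¬ ∃ S ⊆ W, S.card = 4 + 1 ∧ ∀ e ⊆ S, e.card = 4 → E e) → W.card ≤ m := by
    intro W hW h
    rw [hm]
    refine le_csSup ⟨N, ?_⟩ ⟨W, hW, rfl, h⟩
    rintro c ⟨V, hV, rfl, -⟩
    simpa using Finset.card_le_card hV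
  have hpos : 1 ≤ m := by
    refine hle {0} (by simpa using Nat.lt_of_succ_le hN) ?_
    rintro ⟨S, hS, hc, -⟩
    have := Finset.card_le_card hS
    simp at this
    omega
  have hupper : erdosRogersG 5 (2 ^ N) ≤ 1 + m * (m + m) := by
    refine le_trans (Nat.sInf_le (m := sSup {c : ℕ | ∃ W ⊆ Finset.range (2 ^ N), W.card = c ∧
      ¬ ∃ S ⊆ W, S.card = 5 + 1 ∧ ∀ e ⊆ S, e.card = 5 → StepUp E e})
      ⟨StepUp E, stepUp_cliqueFree hfree, rfl⟩) ?_
    refine csSup_le' ?_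
    rintro c ⟨W, hW, rfl, h⟩
    refine card_le_of_stepUp_free (fun T hT hlt => ?_) hW h
    by_contra hcon
    exact absurd (hle T hT hcon) (by omega)
  nlinarith
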